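/- arXiv:0807.2961 — 3 statements merged into one kernel-verified Lean document; each statement's English description precedes it below -/
import Mathlib

section
/- For all generalized affine forms x, y ∈ 𝔸₁, if x ≤ y in the perturbation order then γ(x) ⊆ γ(y). -/
open scoped BigOperators

/-- A generalized affine form: an `ℓ¹` family of noise coefficients `α` together with a
perturbation coefficient `β`. -/
structure AffineForm where
  α : ℕ → ℝ
  β : ℝ
  hsum : Summable fun i => |α i|

namespace AffineForm

/-- `ℓ¹` distance between the `α`-parts of two forms. -/
noncomputable def distL (x y : AffineForm) : ℝ := ∑' i, |x.α i - y.α i|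

/-- `ℓ¹` norm of the `α`-part. -/
noncomputable def normA (x : AffineForm) : ℝ := ∑' i, |x.α i|

/-- Total deviation of the noise part (indices `i ≥ 1`). -/
noncomputable def dev (x : AffineForm) : ℝ := ∑' i, |x.α (i + 1)|

/-- The perturbation order: `x ≤ y` iff `‖αˣ - αʸ‖₁ ≤ βʸ - βˣ`. -/
def le (x y : AffineForm) : Prop := distL x y ≤ y.β - x.β

/-- Lower bound of the concretization. -/
noncomputable def lo (x : AffineForm) : ℝ := x.α 0 - dev x - x.β

/-- Upper bound of the concretization. -/
noncomputable def hi (x : AffineForm) : ℝ := x.α 0 + dev x + x.β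

/-- The concretization interval. -/
noncomputable def γ (x : AffineForm) : Set ℝ := Set.Icc (lo x) (hi x)

theorem summable_abs_sub (x y : AffineForm) : Summable fun i => |x.α i - y.α i| :=
  Summable.of_nonneg_of_le (fun _ => abs_nonneg _) (fun _ => abs_sub _ _) (x.hsum.add y.hsum)

theorem dev_le_dev_add (x y : AffineForm) :
    dev x ≤ dev y + ∑' i, |x.α (i + 1) - y.α (i + 1)| := by
  have hx := (summable_nat_add_iff 1).2 x.hsum
  have hy := (summable_nat_add_iff 1).2 y.hsum
  have hxy := (summable_nat_add_iff 1).2 (summable_abs_sub x y)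
  unfold dev
  rw [← hy.tsum_add hxy]
  refine hx.tsum_le_tsum (fun i => ?_) (hy.add hxy)
  linarith [abs_sub_abs_le_abs_sub (x.α (i + 1)) (y.α (i + 1))]

/-- If `x ≤ y` in the perturbation order then `γ(x) ⊆ γ(y)`. -/
theorem gamma_subset_of_le (x y : AffineForm) (h : x.le y) : γ x ⊆ γ y := by
  have hd := dev_le_dev_add x y
  unfold le distL at h
  rw [(summable_abs_sub x y).tsum_eq_zero_add] at h
  have h₁ := neg_abs_le (x.α 0 - y.α 0)
  have h₂ := le_abs_self (x.α 0 - y.α 0)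
  apply Set.Icc_subset_Icc
  · unfold lo
    linarith
  · unfold hi
    linarith

end AffineForm
end

section
/- Let A be a real n × n matrix all of whose complex eigenvalues have modulus strictly less than 1 (i.e., every element of the spectrum of A viewed as a complex matrix has norm < 1). Then there exists an integer q ≥ 1 such that every row of A^q has ℓ¹-sum strictly less than 1: for every row index i, ∑_j |(A^q)_{ij}| < 1. -/
/-- In a nontrivial complex Banach algebra, an element whose spectrum lies in the open unit disc
has some positive power of norm less than `1`. -/
theorem exists_pow_nnnorm_lt_one_of_spectrum {B : Type*} [NormedRing B] [NormedAlgebra ℂ B]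
    [CompleteSpace B] [Nontrivial B] (a : B) (h : ∀ μ ∈ spectrum ℂ a, ‖μ‖ < 1) :
    ∃ q : ℕ, 1 ≤ q ∧ ‖a ^ q‖₊ < 1 := by
  have hr : spectralRadius ℂ a < ((1 : NNReal) : ENNReal) :=
    spectrum.spectralRadius_lt_of_forall_lt a fun μ hμ => h μ hμ
  have hev := (spectrum.pow_nnnorm_pow_one_div_tendsto_nhds_spectralRadius a).eventually_lt_const hr
  obtain ⟨q, hq, hq1⟩ := (hev.and (Filter.eventually_ge_atTop 1)).exists
  refine ⟨q, hq1, ?_⟩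
  by_contra! hle
  refine hq.not_ge ?_
  rw [ENNReal.coe_one]
  exact ENNReal.one_le_rpow (by exact_mod_cast hle) (by positivity)

open scoped Matrix.Norms.Operator in
/-- If all complex eigenvalues of a real `n × n` matrix `A` have modulus strictly less
than `1`, then some power `A^q` has all its row `ℓ¹`-sums strictly less than `1`. -/
theorem exists_pow_row_sum_lt_one (n : ℕ) (hn : 1 ≤ n)
    (A : Matrix (Fin n) (Fin n) ℝ)
    (h : ∀ μ ∈ spectrum ℂ (A.map Complex.ofReal), ‖μ‖ < 1) :
    ∃ q : ℕ, 1 ≤ q ∧ ∀ i, ∑ j, |(A ^ q) i j| < 1 := by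
  have : Nonempty (Fin n) := ⟨⟨0, hn⟩⟩
  have : CompleteSpace (Matrix (Fin n) (Fin n) ℂ) := FiniteDimensional.complete ℂ _
  obtain ⟨q, hq, hlt⟩ := exists_pow_nnnorm_lt_one_of_spectrum (A.map Complex.ofReal) h
  refine ⟨q, hq, fun i => ?_⟩
  have hpow : A.map Complex.ofReal ^ q = (A ^ q).map Complex.ofReal :=
    (map_pow (Complex.ofRealHom.mapMatrix (m := Fin n)) A q).symm
  rw [hpow, Matrix.linfty_opNNNorm_def] at hlt
  have hi := (Finset.le_sup (f := fun i => ∑ j, ‖(A ^ q).map Complex.ofReal i j‖₊)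
    (Finset.mem_univ i)).trans_lt hlt
  simpa [← NNReal.coe_lt_coe] using hi
end

section
/- Bounded invariants for contractive linear recurrences: let n ≥ 1, let a_1, …, a_n be reals with s = ∑_{i=1}^n |a_i| < 1, let U ≥ 0, and let u : ℕ → ℝ satisfy |u_k| ≤ U for all k. If x : ℕ → ℝ satisfies the recurrence x_{k+n} = ∑_{i=1}^n a_i x_{k+i−1} + u_k for all k, then for every m, |x_m| ≤ max( max_{0 ≤ j < n} |x_j|, U/(1 − s) ). -/
/-- Bounded invariants for contractive linear recurrences: if `∑ |aᵢ| < 1` and the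
inputs are bounded by `U`, then any solution of the recurrence
`x (k + n) = ∑ aᵢ x (k + i) + u k` is bounded by
`max (max_{0 ≤ j < n} |x j|) (U / (1 - ∑ |aᵢ|))`. -/
theorem contractive_recurrence_bounded (n : ℕ) (hn : 1 ≤ n) (a : Fin n → ℝ)
    (hs : ∑ i, |a i| < 1) (U : ℝ) (hU : 0 ≤ U)
    (u : ℕ → ℝ) (hu : ∀ k, |u k| ≤ U)
    (x : ℕ → ℝ) (hx : ∀ k, x (k + n) = (∑ i : Fin n, a i * x (k + (i : ℕ))) + u k) :
    ∀ m, |x m| ≤ max (⨆ j : Fin n, |x (j : ℕ)|) (U / (1 - ∑ i, |a i|)) := by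
  intro m
  set M := max (⨆ j : Fin n, |x (j : ℕ)|) (U / (1 - ∑ i, |a i|))
  have hUM : U ≤ M * (1 - ∑ i, |a i|) :=
    (div_le_iff₀ (sub_pos.mpr hs)).mp (le_max_right _ _)
  induction m using Nat.strong_induction_on with
  | _ m ih =>
    rcases lt_or_ge m n with hmn | hmn
    · exact (le_ciSup (f := fun j : Fin n => |x (j : ℕ)|)
        (Set.finite_range _).bddAbove ⟨m, hmn⟩).trans (le_max_left _ _)
    · obtain ⟨k, rfl⟩ := Nat.exists_eq_add_of_le' hmn
      rw [hx k]
      calc |(∑ i : Fin n, a i * x (k + (i : ℕ))) + u k|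
          ≤ |∑ i : Fin n, a i * x (k + (i : ℕ))| + |u k| := abs_add_le _ _
        _ ≤ (∑ i : Fin n, |a i * x (k + (i : ℕ))|) + U :=
            add_le_add (Finset.abs_sum_le_sum_abs _ _) (hu k)
        _ ≤ (∑ i : Fin n, |a i| * M) + U := by
            gcongr with i
            rw [abs_mul]
            exact mul_le_mul_of_nonneg_left (ih _ (by omega)) (abs_nonneg _)
        _ ≤ M := by
            rw [← Finset.sum_mul]
            linarith
end
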